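/- Let ρ_i ∈ T₊(H_i) for i = 1, 2, and suppose (ρ^{(n)}) is a sequence of positive semidefinite trace class operators on H = H₁ ⊗ H₂ converging in the weak operator topology to ρ ∈ T₊(H), and such that ‖tr₁ρ^{(n)} − ρ₂‖₁ + ‖tr₂ρ^{(n)} − ρ₁‖₁ → 0. Then ‖ρ^{(n)} − ρ‖₁ → 0, and in particular tr ρ = tr ρ₁ = tr ρ₂. -/

import Mathlib

noncomputable section

open Filter Topology

local notation "⟪" x ", " y "⟫" => @inner ℂ _ _ x y

/-- The trace norm of a bounded operator on a complex Hilbert space, defined as the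
supremum over all pairs of finite orthonormal families of `∑ i, ‖⟪L (x i), y i⟫‖`.
For trace class operators this equals the sum of the singular values, and an operator
is trace class iff this is finite. -/
def traceNorm {H : Type*} [NormedAddCommGroup H] [InnerProductSpace ℂ H]
    (L : H →L[ℂ] H) : ENNReal :=
  ⨆ (n : ℕ) (x : Fin n → H) (_ : Orthonormal ℂ x) (y : Fin n → H) (_ : Orthonormal ℂ y),
    ∑ i, (‖⟪L (x i), y i⟫‖₊ : ENNReal)

/-- index set of a chosen Hilbert basis of `H` -/
def hIndex (H : Type*) [NormedAddCommGroup H] [InnerProductSpace ℂ H] [CompleteSpace H] :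
    Set H :=
  (exists_hilbertBasis ℂ H).choose

/-- a chosen Hilbert basis of `H` -/
def hBasis (H : Type*) [NormedAddCommGroup H] [InnerProductSpace ℂ H] [CompleteSpace H] :
    HilbertBasis (hIndex H) ℂ H :=
  (exists_hilbertBasis ℂ H).choose_spec.choose

/-- the trace of an operator (meaningful for trace class operators, where it is
independent of the chosen Hilbert basis) -/
def opTrace {H : Type*} [NormedAddCommGroup H] [InnerProductSpace ℂ H] [CompleteSpace H]
    (L : H →L[ℂ] H) : ℂ :=
  ∑' i : hIndex H, ⟪(hBasis H i : H), L (hBasis H i)⟫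

/-- `tp` realizes `H` as the Hilbert tensor product of `H₁` and `H₂`:
it is bilinear, satisfies `⟪x ⊗ y, u ⊗ v⟫ = ⟪x, u⟫⟪y, v⟫`, and the span of the
elementary tensors is dense in `H`. -/
structure IsHilbertTensor {H₁ H₂ H : Type*}
    [NormedAddCommGroup H₁] [InnerProductSpace ℂ H₁]
    [NormedAddCommGroup H₂] [InnerProductSpace ℂ H₂]
    [NormedAddCommGroup H] [InnerProductSpace ℂ H]
    (tp : H₁ → H₂ → H) : Prop where
  inner_tp : ∀ (x u : H₁) (y v : H₂), ⟪tp x y, tp u v⟫ = ⟪x, u⟫ * ⟪y, v⟫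
  add_left : ∀ (x x' : H₁) (y : H₂), tp (x + x') y = tp x y + tp x' y
  smul_left : ∀ (c : ℂ) (x : H₁) (y : H₂), tp (c • x) y = c • tp x y
  add_right : ∀ (x : H₁) (y y' : H₂), tp x (y + y') = tp x y + tp x y'
  smul_right : ∀ (c : ℂ) (x : H₁) (y : H₂), tp x (c • y) = c • tp x y
  dense_span : Dense (Submodule.span ℂ {v : H | ∃ x y, v = tp x y} : Set H)

/-- `C` is the partial trace over `H₂` (denoted `tr₂ F`) of the operator `F` on
`H = H₁ ⊗ H₂`: its matrix elements are `⟨(tr₂ F) x, y⟩ = ∑_j ⟨F (x ⊗ e_j), y ⊗ e_j⟩`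
for a Hilbert basis `(e_j)` of `H₂`; this characterizes the map determined by
`tr₂((x⊗y)(u⊗v)*) = ⟨y,v⟩ x u*`. -/
def IsPartialTrace₂ {H₁ H₂ H : Type*}
    [NormedAddCommGroup H₁] [InnerProductSpace ℂ H₁] [CompleteSpace H₁]
    [NormedAddCommGroup H₂] [InnerProductSpace ℂ H₂] [CompleteSpace H₂]
    [NormedAddCommGroup H] [InnerProductSpace ℂ H]
    (tp : H₁ → H₂ → H) (F : H →L[ℂ] H) (C : H₁ →L[ℂ] H₁) : Prop :=
  ∀ x y : H₁, ⟪y, C x⟫ = ∑' j : hIndex H₂, ⟪tp y (hBasis H₂ j), F (tp x (hBasis H₂ j))⟫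

/-- `D` is the partial trace over `H₁` (denoted `tr₁ F`) of the operator `F` on
`H = H₁ ⊗ H₂`. -/
def IsPartialTrace₁ {H₁ H₂ H : Type*}
    [NormedAddCommGroup H₁] [InnerProductSpace ℂ H₁] [CompleteSpace H₁]
    [NormedAddCommGroup H₂] [InnerProductSpace ℂ H₂] [CompleteSpace H₂]
    [NormedAddCommGroup H] [InnerProductSpace ℂ H]
    (tp : H₁ → H₂ → H) (F : H →L[ℂ] H) (D : H₂ →L[ℂ] H₂) : Prop :=
  ∀ u v : H₂, ⟪v, D u⟫ = ∑' i : hIndex H₁, ⟪tp (hBasis H₁ i) v, F (tp (hBasis H₁ i) u)⟫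


theorem aux_parseval {K ι : Type*} [NormedAddCommGroup K] [InnerProductSpace ℂ K]
    (b : HilbertBasis ι ℂ K) (x : K) : ∑' i, ‖⟪b i, x⟫‖ₑ ^ 2 = ‖x‖ₑ ^ 2 := by
  have h := b.hasSum_inner_mul_inner x x
  have h2 : HasSum (fun i => ‖⟪b i, x⟫‖ ^ 2) (‖x‖ ^ 2) := by
    have h3 := Complex.hasSum_re h
    convert! h3 using 1
    · ext i
      rw [← inner_conj_symm x (b i), Complex.conj_mul']
      norm_cast
    · rw [inner_self_eq_norm_sq_to_K]; norm_cast
  have e : ∀ z : ℂ, ‖z‖ₑ ^ 2 = ENNReal.ofReal (‖z‖ ^ 2) := fun z => by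
    rw [ENNReal.ofReal_pow (norm_nonneg _), ofReal_norm]
  simp_rw [e]
  rw [← ENNReal.ofReal_tsum_of_nonneg (fun i => by positivity) h2.summable, h2.tsum_eq,
    ENNReal.ofReal_pow (norm_nonneg _), ofReal_norm]

theorem aux_bessel {K ι : Type*} [NormedAddCommGroup K] [InnerProductSpace ℂ K]
    {b : ι → K} (hb : Orthonormal ℂ b) (x : K) : ∑' i, ‖⟪b i, x⟫‖ₑ ^ 2 ≤ ‖x‖ₑ ^ 2 := by
  have e : ∀ z : ℂ, ‖z‖ₑ ^ 2 = ENNReal.ofReal (‖z‖ ^ 2) := fun z => by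
    rw [ENNReal.ofReal_pow (norm_nonneg _), ofReal_norm]
  simp_rw [e]
  rw [← ENNReal.ofReal_tsum_of_nonneg (fun i => by positivity) (hb.inner_products_summable x),
    ← ofReal_norm, ← ENNReal.ofReal_pow (norm_nonneg _)]
  exact ENNReal.ofReal_le_ofReal (hb.tsum_inner_products_le x)

theorem aux_hs {K ι κ : Type*} [NormedAddCommGroup K] [InnerProductSpace ℂ K] [CompleteSpace K]
    (b : HilbertBasis ι ℂ K) {x : κ → K} (hx : Orthonormal ℂ x) (S : K →L[ℂ] K) :
    ∑' k, ‖S (x k)‖ₑ ^ 2 ≤ ∑' i, ‖S (b i)‖ₑ ^ 2 := by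
  have key : ∀ (u v : K), ‖⟪u, S v⟫‖ₑ = ‖⟪v, ContinuousLinearMap.adjoint S u⟫‖ₑ := fun u v => by
    rw [← ContinuousLinearMap.adjoint_inner_left, ← inner_conj_symm, RCLike.enorm_conj]
  calc ∑' k, ‖S (x k)‖ₑ ^ 2 = ∑' k, ∑' i, ‖⟪b i, S (x k)⟫‖ₑ ^ 2 := by
        simp_rw [aux_parseval b]
    _ = ∑' i, ∑' k, ‖⟪x k, ContinuousLinearMap.adjoint S (b i)⟫‖ₑ ^ 2 := by
        rw [ENNReal.tsum_comm]; simp_rw [key]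
    _ ≤ ∑' i, ‖ContinuousLinearMap.adjoint S (b i)‖ₑ ^ 2 :=
        ENNReal.tsum_le_tsum fun i => aux_bessel hx _
    _ = ∑' i, ∑' j, ‖⟪b j, ContinuousLinearMap.adjoint S (b i)⟫‖ₑ ^ 2 := by
        simp_rw [aux_parseval b]
    _ = ∑' j, ∑' i, ‖⟪b i, S (b j)⟫‖ₑ ^ 2 := by
        rw [ENNReal.tsum_comm]; simp_rw [key]
    _ = _ := by simp_rw [aux_parseval b]

theorem aux_traceNorm_le {K : Type*} [NormedAddCommGroup K] [InnerProductSpace ℂ K]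
    (A : K →L[ℂ] K) (c : ENNReal)
    (h : ∀ (n : ℕ) (x y : Fin n → K), Orthonormal ℂ x → Orthonormal ℂ y →
      ∑ i, ‖⟪A (x i), y i⟫‖ₑ ≤ c) : traceNorm A ≤ c :=
  iSup_le fun n => iSup_le fun x => iSup_le fun hx => iSup_le fun y => iSup_le fun hy =>
    h n x y hx hy

theorem aux_le_traceNorm {K : Type*} [NormedAddCommGroup K] [InnerProductSpace ℂ K]
    (A : K →L[ℂ] K) {n : ℕ} (x y : Fin n → K) (hx : Orthonormal ℂ x) (hy : Orthonormal ℂ y) :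
    ∑ i, ‖⟪A (x i), y i⟫‖ₑ ≤ traceNorm A := by
  unfold traceNorm
  exact le_iSup_of_le n (le_iSup_of_le x (le_iSup_of_le hx (le_iSup_of_le y
    (le_iSup_of_le hy le_rfl))))

theorem aux_traceNorm_add {K : Type*} [NormedAddCommGroup K] [InnerProductSpace ℂ K]
    (A B : K →L[ℂ] K) : traceNorm (A + B) ≤ traceNorm A + traceNorm B := by
  refine aux_traceNorm_le _ _ fun n x y hx hy => ?_
  calc ∑ i, ‖⟪(A + B) (x i), y i⟫‖ₑ ≤ ∑ i, (‖⟪A (x i), y i⟫‖ₑ + ‖⟪B (x i), y i⟫‖ₑ) := by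
        refine Finset.sum_le_sum fun i _ => ?_
        rw [add_apply, inner_add_left]
        exact enorm_add_le _ _
    _ ≤ _ := by
        rw [Finset.sum_add_distrib]
        exact add_le_add (aux_le_traceNorm A x y hx hy) (aux_le_traceNorm B x y hx hy)

theorem aux_traceNorm_neg {K : Type*} [NormedAddCommGroup K] [InnerProductSpace ℂ K]
    (A : K →L[ℂ] K) : traceNorm (-A) = traceNorm A := by
  unfold traceNorm
  simp

theorem aux_diag_le {K ι : Type*} [NormedAddCommGroup K] [InnerProductSpace ℂ K]
    (A : K →L[ℂ] K) {b : ι → K} (hb : Orthonormal ℂ b) :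
    ∑' i, ‖⟪b i, A (b i)⟫‖ₑ ≤ traceNorm A := by
  rw [ENNReal.tsum_eq_iSup_sum]
  refine iSup_le fun s => ?_
  have h := aux_le_traceNorm A (fun k : Fin s.card => b (s.equivFin.symm k))
    (fun k : Fin s.card => b (s.equivFin.symm k))
    (hb.comp _ (Subtype.val_injective.comp s.equivFin.symm.injective))
    (hb.comp _ (Subtype.val_injective.comp s.equivFin.symm.injective))
  refine le_trans (le_of_eq ?_) h
  rw [Equiv.sum_comp s.equivFin.symm (fun i : s => ‖⟪A (b i), b i⟫‖ₑ),
    Finset.sum_coe_sort s (fun i => ‖⟪A (b i), b i⟫‖ₑ)]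
  refine Finset.sum_congr rfl fun i _ => ?_
  rw [← inner_conj_symm, RCLike.enorm_conj]

/-- diagonal entries, as extended nonnegative reals -/
def dgE {K : Type*} [NormedAddCommGroup K] [InnerProductSpace ℂ K]
    (A : K →L[ℂ] K) (v : K) : ENNReal := ENNReal.ofReal (⟪v, A v⟫).re

theorem aux_dg_le {K : Type*} [NormedAddCommGroup K] [InnerProductSpace ℂ K]
    (A : K →L[ℂ] K) (v : K) : dgE A v ≤ ‖⟪v, A v⟫‖ₑ := by
  unfold dgE
  rw [← ofReal_norm]
  exact ENNReal.ofReal_le_ofReal (Complex.re_le_norm _)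

theorem aux_dg_tsum_le {K ι : Type*} [NormedAddCommGroup K] [InnerProductSpace ℂ K]
    (A : K →L[ℂ] K) {b : ι → K} (hb : Orthonormal ℂ b) :
    ∑' i, dgE A (b i) ≤ traceNorm A :=
  (ENNReal.tsum_le_tsum fun i => aux_dg_le A (b i)).trans (aux_diag_le A hb)

theorem aux_dg_diff {K ι : Type*} [NormedAddCommGroup K] [InnerProductSpace ℂ K]
    (A B : K →L[ℂ] K) {b : ι → K} (hb : Orthonormal ℂ b) :
    ∑' i, dgE A (b i) ≤ ∑' i, dgE B (b i) + traceNorm (A - B) := by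
  refine le_trans ?_ (add_le_add le_rfl (aux_dg_tsum_le (A - B) hb))
  rw [← ENNReal.tsum_add]
  refine ENNReal.tsum_le_tsum fun i => ?_
  unfold dgE
  refine le_trans (le_of_eq ?_) ENNReal.ofReal_add_le
  congr 1
  simp [inner_sub_right]

theorem aux_sub_comm {K : Type*} [NormedAddCommGroup K] [InnerProductSpace ℂ K]
    (A B : K →L[ℂ] K) : traceNorm (A - B) = traceNorm (B - A) := by
  rw [← aux_traceNorm_neg, neg_sub]

theorem aux_sqrt {K : Type*} [NormedAddCommGroup K] [InnerProductSpace ℂ K] [CompleteSpace K]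
    (A : K →L[ℂ] K) (hA : A.IsPositive) :
    ∃ S : K →L[ℂ] K, (∀ x y, ⟪A x, y⟫ = ⟪S x, S y⟫) ∧ ∀ x, dgE A x = ‖S x‖ₑ ^ 2 := by
  obtain ⟨S, hS⟩ := CStarAlgebra.nonneg_iff_eq_star_mul_self.mp
    ((ContinuousLinearMap.nonneg_iff_isPositive A).2 hA)
  have h : ∀ x y, ⟪A x, y⟫ = ⟪S x, S y⟫ := fun x y => by
    rw [hS, ContinuousLinearMap.star_eq_adjoint, mul_apply_eq_comp,
      ContinuousLinearMap.adjoint_inner_left]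
  refine ⟨S, h, fun x => ?_⟩
  unfold dgE
  rw [← inner_conj_symm, Complex.conj_re, h, inner_self_eq_norm_sq_to_K,
    ← ofReal_norm, ← ENNReal.ofReal_pow (norm_nonneg _)]
  norm_cast

theorem aux_sandwich {K ι : Type*} [NormedAddCommGroup K] [InnerProductSpace ℂ K] [CompleteSpace K]
    (b : HilbertBasis ι ℂ K) (A U V : K →L[ℂ] K) (h : ∀ x y, ⟪A x, y⟫ = ⟪U x, V y⟫) :
    traceNorm A ≤ (∑' i, ‖U (b i)‖ₑ ^ 2) ^ (1 / 2 : ℝ) * (∑' i, ‖V (b i)‖ₑ ^ 2) ^ (1 / 2 : ℝ) := by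
  refine aux_traceNorm_le _ _ fun n x y hx hy => ?_
  calc ∑ i, ‖⟪A (x i), y i⟫‖ₑ ≤ ∑ i, ‖U (x i)‖ₑ * ‖V (y i)‖ₑ := by
        refine Finset.sum_le_sum fun i _ => ?_
        rw [h]
        rw [← ofReal_norm, ← ofReal_norm, ← ofReal_norm,
          ← ENNReal.ofReal_mul (norm_nonneg _)]
        exact ENNReal.ofReal_le_ofReal (norm_inner_le_norm _ _)
    _ ≤ (∑ i, ‖U (x i)‖ₑ ^ (2 : ℝ)) ^ (1 / 2 : ℝ) * (∑ i, ‖V (y i)‖ₑ ^ (2 : ℝ)) ^ (1 / 2 : ℝ) :=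
        ENNReal.inner_le_Lp_mul_Lq _ _ _ Real.HolderConjugate.two_two
    _ ≤ _ := by
        have h1 := aux_hs b hx U
        have h2 := aux_hs b hy V
        rw [tsum_fintype] at h1 h2
        simp only [ENNReal.rpow_ofNat]
        gcongr

theorem aux_basis_indep {K ι κ : Type*} [NormedAddCommGroup K] [InnerProductSpace ℂ K]
    [CompleteSpace K] (b : HilbertBasis ι ℂ K) (c : HilbertBasis κ ℂ K)
    (A : K →L[ℂ] K) (hA : A.IsPositive) :
    ∑' i, dgE A (b i) = ∑' i, dgE A (c i) := by
  obtain ⟨S, -, h⟩ := aux_sqrt A hA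
  simp_rw [h]
  exact le_antisymm (aux_hs c b.orthonormal S) (aux_hs b c.orthonormal S)

open scoped ComplexOrder in
theorem aux_tsum_complex {ι : Type*} (z : ι → ℂ) (r : ι → ENNReal)
    (hz : ∀ i, 0 ≤ z i) (hr : ∀ i, r i = ENNReal.ofReal (z i).re) (hs : ∑' i, r i ≠ ⊤) :
    ∑' i, z i = ((∑' i, r i).toReal : ℂ) := by
  have h : ∀ i, z i = (((r i).toReal : ℝ) : ℂ) := fun i => by
    have := Complex.nonneg_iff.1 (hz i)
    rw [hr, ENNReal.toReal_ofReal this.1]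
    apply Complex.ext
    · simp
    · simp [← this.2]
  simp_rw [h]
  rw [← Complex.ofReal_tsum, ENNReal.tsum_toReal_eq]
  intro i
  rw [hr]; exact ENNReal.ofReal_ne_top

open scoped ComplexOrder in
theorem aux_pos_nonneg {K : Type*} [NormedAddCommGroup K] [InnerProductSpace ℂ K]
    [CompleteSpace K] (A : K →L[ℂ] K) (hA : A.IsPositive) (v : K) : 0 ≤ ⟪v, A v⟫ :=
  hA.inner_nonneg_right v

open scoped ComplexOrder in
theorem aux_opTrace {K : Type*} [NormedAddCommGroup K] [InnerProductSpace ℂ K]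
    [CompleteSpace K] (A : K →L[ℂ] K) (hA : A.IsPositive) (htc : traceNorm A ≠ ⊤) :
    opTrace A = ((∑' i, dgE A (hBasis K i)).toReal : ℂ) :=
  aux_tsum_complex _ _ (fun i => aux_pos_nonneg A hA _) (fun _ => rfl)
    (ne_top_of_le_ne_top htc (aux_dg_tsum_le A (hBasis K).orthonormal))

/-- finite rank projection onto the span of `b i`, `i ∈ F` -/
def finP {K ι : Type*} [NormedAddCommGroup K] [InnerProductSpace ℂ K]
    (b : ι → K) (F : Finset ι) : K →L[ℂ] K :=
  ∑ i ∈ F, (innerSL ℂ (b i)).smulRight (b i)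

theorem aux_finP_apply {K ι : Type*} [NormedAddCommGroup K] [InnerProductSpace ℂ K]
    (b : ι → K) (F : Finset ι) (x : K) : finP b F x = ∑ i ∈ F, ⟪b i, x⟫ • b i := by
  simp [finP]

theorem aux_finP_symm {K ι : Type*} [NormedAddCommGroup K] [InnerProductSpace ℂ K]
    (b : ι → K) (F : Finset ι) (x y : K) : ⟪finP b F x, y⟫ = ⟪x, finP b F y⟫ := by
  simp only [aux_finP_apply, sum_inner, inner_sum, inner_smul_left, inner_smul_right,
    inner_conj_symm]
  exact Finset.sum_congr rfl fun i _ => mul_comm _ _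

open Classical in
theorem aux_finP_basis {K ι : Type*} [NormedAddCommGroup K] [InnerProductSpace ℂ K]
    {b : ι → K} (hb : Orthonormal ℂ b) (F : Finset ι) (j : ι) :
    finP b F (b j) = if j ∈ F then b j else 0 := by
  rw [aux_finP_apply]
  simp [orthonormal_iff_ite.1 hb]

open Classical in
/-- tail sums -/
def tailE {ι : Type*} (f : ι → ENNReal) (F : Finset ι) : ENNReal :=
  ∑' i, if i ∈ F then 0 else f i

theorem aux_tail_le {ι : Type*} (f : ι → ENNReal) (F : Finset ι) : tailE f F ≤ ∑' i, f i := by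
  classical
  refine ENNReal.tsum_le_tsum fun i => ?_
  split_ifs <;> simp

theorem aux_tail_anti {ι : Type*} (f : ι → ENNReal) {F G : Finset ι} (h : F ⊆ G) :
    tailE f G ≤ tailE f F := by
  classical
  refine ENNReal.tsum_le_tsum fun i => ?_
  by_cases hi : i ∈ F
  · simp [hi, h hi]
  · simp only [hi, if_false]
    split_ifs <;> simp

theorem aux_tail_tendsto {ι : Type*} (f : ι → ENNReal) (hf : ∑' i, f i ≠ ⊤) :
    Tendsto (tailE f) atTop (𝓝 0) := by
  classical
  refine (ENNReal.tendsto_tsum_compl_atTop_zero hf).congr fun F => ?_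
  have := tsum_subtype {x | x ∉ F} f
  refine Eq.trans this (tsum_congr fun i => ?_)
  by_cases hi : i ∈ F <;> simp [hi]

theorem aux_trunc {K ι : Type*} [NormedAddCommGroup K] [InnerProductSpace ℂ K] [CompleteSpace K]
    (b : HilbertBasis ι ℂ K) (A : K →L[ℂ] K) (hA : A.IsPositive) (F : Finset ι) :
    traceNorm (A - finP b F * A * finP b F) ≤
      2 * ((∑' i, dgE A (b i)) ^ (1 / 2 : ℝ) * (tailE (fun i => dgE A (b i)) F) ^ (1 / 2 : ℝ)) := by
  classical
  obtain ⟨S, hS, hd⟩ := aux_sqrt A hA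
  set P := finP b F with hP
  have hPs : ∀ x y, ⟪P x, y⟫ = ⟪x, P y⟫ := aux_finP_symm b F
  have hPb : ∀ j, P (b j) = if j ∈ F then b j else 0 := aux_finP_basis b.orthonormal F
  have e : A - P * A * P = (A - P * A) + (P * A - P * A * P) := by abel
  have hQ : ∑' i, ‖(S * (1 - P)) (b i)‖ₑ ^ 2 = tailE (fun i => dgE A (b i)) F := by
    refine tsum_congr fun i => ?_
    by_cases hi : i ∈ F <;> simp [hi, hPb, hd]
  have hPP : ∑' i, ‖(S * P) (b i)‖ₑ ^ 2 ≤ ∑' i, dgE A (b i) := by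
    refine ENNReal.tsum_le_tsum fun i => ?_
    by_cases hi : i ∈ F <;> simp [hi, hPb, hd]
  have h1 : traceNorm (A - P * A) ≤
      (∑' i, dgE A (b i)) ^ (1 / 2 : ℝ) * (tailE (fun i => dgE A (b i)) F) ^ (1 / 2 : ℝ) := by
    have := aux_sandwich b (A - P * A) S (S * (1 - P)) (fun x y => by
      simp [inner_sub_left, inner_sub_right, hPs, hS])
    rw [hQ] at this
    simpa only [hd] using this
  have h2 : traceNorm (P * A - P * A * P) ≤
      (∑' i, dgE A (b i)) ^ (1 / 2 : ℝ) * (tailE (fun i => dgE A (b i)) F) ^ (1 / 2 : ℝ) := by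
    have := aux_sandwich b (P * A - P * A * P) (S * (1 - P)) (S * P) (fun x y => by
      simp [inner_sub_left, hPs, hS])
    rw [hQ, mul_comm] at this
    refine this.trans ?_
    gcongr
  rw [e, two_mul]
  exact (aux_traceNorm_add _ _).trans (add_le_add h1 h2)

theorem aux_finite {K ι : Type*} [NormedAddCommGroup K] [InnerProductSpace ℂ K]
    {b : ι → K} (hb : Orthonormal ℂ b) (B : K →L[ℂ] K) (F : Finset ι) :
    traceNorm (finP b F * B * finP b F) ≤ ∑ i ∈ F, ∑ j ∈ F, ‖⟪b i, B (b j)⟫‖ₑ := by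
  refine aux_traceNorm_le _ _ fun n x y hx hy => ?_
  have one : ∀ (z : Fin n → K), Orthonormal ℂ z → ∀ i,
      (∑ k, ‖⟪b i, z k⟫‖ₑ ^ (2 : ℝ)) ^ (1 / 2 : ℝ) ≤ 1 := fun z hz i => by
    have h := aux_bessel hz (b i)
    rw [tsum_fintype, ← ofReal_norm, hb.1 i] at h
    refine ENNReal.rpow_le_one ?_ (by norm_num)
    simp only [ENNReal.rpow_ofNat]
    refine le_trans (le_of_eq (Finset.sum_congr rfl fun k _ => ?_)) (h.trans (by simp))
    rw [← inner_conj_symm, RCLike.enorm_conj]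
  have cs : ∀ i j, ∑ k, ‖⟪b j, x k⟫‖ₑ * ‖⟪b i, y k⟫‖ₑ ≤ 1 := fun i j =>
    (ENNReal.inner_le_Lp_mul_Lq _ _ _ Real.HolderConjugate.two_two).trans
      (mul_le_one' (one x hx j) (one y hy i))
  have pt : ∀ k, ‖⟪(finP b F * B * finP b F) (x k), y k⟫‖ₑ ≤
      ∑ i ∈ F, ∑ j ∈ F, ‖⟪b i, B (b j)⟫‖ₑ * (‖⟪b j, x k⟫‖ₑ * ‖⟪b i, y k⟫‖ₑ) := fun k => by
    rw [mul_apply_eq_comp, mul_apply_eq_comp, aux_finP_symm, aux_finP_apply, aux_finP_apply,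
      inner_sum]
    refine (enorm_sum_le _ _).trans (Finset.sum_le_sum fun i _ => ?_)
    rw [map_sum, sum_inner]
    refine (enorm_sum_le _ _).trans (Finset.sum_le_sum fun j _ => ?_)
    rw [map_smul, inner_smul_left, inner_smul_right, enorm_mul, enorm_mul, RCLike.enorm_conj,
      ← inner_conj_symm (B (b j)) (b i), RCLike.enorm_conj]
    apply le_of_eq
    ring
  calc _ ≤ ∑ k, ∑ i ∈ F, ∑ j ∈ F, ‖⟪b i, B (b j)⟫‖ₑ * (‖⟪b j, x k⟫‖ₑ * ‖⟪b i, y k⟫‖ₑ) :=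
        Finset.sum_le_sum fun k _ => pt k
    _ = ∑ i ∈ F, ∑ j ∈ F, ‖⟪b i, B (b j)⟫‖ₑ * ∑ k, (‖⟪b j, x k⟫‖ₑ * ‖⟪b i, y k⟫‖ₑ) := by
        rw [Finset.sum_comm]
        refine Finset.sum_congr rfl fun i _ => ?_
        rw [Finset.sum_comm]
        refine Finset.sum_congr rfl fun j _ => ?_
        rw [Finset.mul_sum]
    _ ≤ _ := Finset.sum_le_sum fun i _ => Finset.sum_le_sum fun j _ =>
        mul_le_of_le_one_right' (cs i j)

theorem aux_swap {E₁ E₂ E : Type*}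
    [NormedAddCommGroup E₁] [InnerProductSpace ℂ E₁]
    [NormedAddCommGroup E₂] [InnerProductSpace ℂ E₂]
    [NormedAddCommGroup E] [InnerProductSpace ℂ E]
    {tp : E₁ → E₂ → E} (h : IsHilbertTensor tp) : IsHilbertTensor (fun y x => tp x y) where
  inner_tp x u y v := by rw [h.inner_tp, mul_comm]
  add_left x x' y := h.add_right _ _ _
  smul_left c x y := h.smul_right _ _ _
  add_right x x' y := h.add_left _ _ _
  smul_right c x y := h.smul_left _ _ _
  dense_span := by
    have : {v : E | ∃ x y, v = tp y x} = {v : E | ∃ x y, v = tp x y} := by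
      ext v; exact exists_comm
    rw [this]; exact h.dense_span

/-- `x ↦ x ⊗ y` as a continuous linear map -/
theorem aux_clm {E₁ E₂ E : Type*}
    [NormedAddCommGroup E₁] [InnerProductSpace ℂ E₁]
    [NormedAddCommGroup E₂] [InnerProductSpace ℂ E₂]
    [NormedAddCommGroup E] [InnerProductSpace ℂ E]
    {tp : E₁ → E₂ → E} (h : IsHilbertTensor tp) (y : E₂) :
    ∃ L : E₁ →L[ℂ] E, ∀ x, L x = tp x y := by
  refine ⟨LinearMap.mkContinuous
    { toFun := fun x => tp x y
      map_add' := fun x x' => h.add_left x x' y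
      map_smul' := fun c x => h.smul_left c x y } ‖y‖ fun x => ?_, fun x => rfl⟩
  have h1 := h.inner_tp x x y y
  rw [inner_self_eq_norm_sq_to_K, inner_self_eq_norm_sq_to_K, inner_self_eq_norm_sq_to_K] at h1
  have h2 : ‖tp x y‖ ^ 2 = (‖y‖ * ‖x‖) ^ 2 := by
    have : ‖tp x y‖ ^ 2 = ‖x‖ ^ 2 * ‖y‖ ^ 2 := by exact_mod_cast h1
    rw [this]; ring
  exact le_of_eq ((sq_eq_sq₀ (norm_nonneg _) (by positivity)).1 h2)

theorem aux_zero {E₁ E₂ E ι : Type*}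
    [NormedAddCommGroup E₁] [InnerProductSpace ℂ E₁]
    [NormedAddCommGroup E₂] [InnerProductSpace ℂ E₂]
    [NormedAddCommGroup E] [InnerProductSpace ℂ E]
    {tp : E₁ → E₂ → E} (h : IsHilbertTensor tp) (b : HilbertBasis ι ℂ E₁) (v : E) (y : E₂)
    (hv : ∀ i, ⟪v, tp (b i) y⟫ = 0) (x : E₁) : ⟪v, tp x y⟫ = 0 := by
  obtain ⟨L, hL⟩ := aux_clm h y
  have hd : Dense (Submodule.span ℂ (Set.range b) : Set E₁) := by
    exact Submodule.dense_iff_topologicalClosure_eq_top.2 b.dense_span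
  have := ContinuousLinearMap.ext_on (f := (innerSL ℂ v).comp L) (g := 0) hd (by
    rintro _ ⟨i, rfl⟩
    simp [hL, hv])
  have := congrArg (fun T => T x) this
  simpa [hL] using this

theorem aux_prodBasis {E₁ E₂ E ι κ : Type*}
    [NormedAddCommGroup E₁] [InnerProductSpace ℂ E₁]
    [NormedAddCommGroup E₂] [InnerProductSpace ℂ E₂]
    [NormedAddCommGroup E] [InnerProductSpace ℂ E] [CompleteSpace E]
    {tp : E₁ → E₂ → E} (h : IsHilbertTensor tp)
    (b : HilbertBasis ι ℂ E₁) (c : HilbertBasis κ ℂ E₂) :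
    ∃ g : HilbertBasis (ι × κ) ℂ E, ∀ p, g p = tp (b p.1) (c p.2) := by
  classical
  have ho : Orthonormal ℂ (fun p : ι × κ => tp (b p.1) (c p.2)) := by
    rw [orthonormal_iff_ite]
    rintro ⟨i, j⟩ ⟨i', j'⟩
    rw [h.inner_tp, orthonormal_iff_ite.1 b.orthonormal, orthonormal_iff_ite.1 c.orthonormal]
    by_cases h1 : i = i' <;> by_cases h2 : j = j' <;> simp [h1, h2]
  have hsp : (Submodule.span ℂ (Set.range (fun p : ι × κ => tp (b p.1) (c p.2))))ᗮ = ⊥ := by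
    rw [Submodule.eq_bot_iff]
    intro v hv
    have h0 : ∀ i j, ⟪v, tp (b i) (c j)⟫ = 0 := fun i j =>
      (Submodule.mem_orthogonal' _ v).1 hv _ (Submodule.subset_span ⟨(i, j), rfl⟩)
    have h1 : ∀ x j, ⟪v, tp x (c j)⟫ = 0 := fun x j => aux_zero h b v _ (fun i => h0 i j) x
    have h2 : ∀ x y, ⟪v, tp x y⟫ = 0 := fun x y =>
      aux_zero (aux_swap h) c v x (fun j => h1 x j) y
    have := ContinuousLinearMap.ext_on (f := innerSL ℂ v) (g := 0) h.dense_span (by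
      rintro _ ⟨x, y, rfl⟩
      simp [h2])
    have := congrArg (fun T => T v) this
    simpa using this
  exact ⟨HilbertBasis.mkOfOrthogonalEqBot ho hsp, fun p => by
    rw [HilbertBasis.coe_mkOfOrthogonalEqBot]⟩

open scoped ComplexOrder in
theorem aux_marg {K κ : Type*} [NormedAddCommGroup K] [InnerProductSpace ℂ K] [CompleteSpace K]
    (A : K →L[ℂ] K) (hA : A.IsPositive) (g : κ → K) (hs : ∑' j, dgE A (g j) ≠ ⊤)
    (z : ℂ) (hz : z = ∑' j, ⟪g j, A (g j)⟫) : ENNReal.ofReal z.re = ∑' j, dgE A (g j) := by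
  have := aux_tsum_complex (fun j => ⟪g j, A (g j)⟫) (fun j => dgE A (g j))
    (fun i => aux_pos_nonneg A hA _) (fun _ => rfl) hs
  rw [hz, this, Complex.ofReal_re, ENNReal.ofReal_toReal hs]

theorem aux_dg_tail_diff {K ι : Type*} [NormedAddCommGroup K] [InnerProductSpace ℂ K]
    (A B : K →L[ℂ] K) {b : ι → K} (hb : Orthonormal ℂ b) (F : Finset ι) :
    tailE (fun i => dgE A (b i)) F ≤ tailE (fun i => dgE B (b i)) F + traceNorm (A - B) := by
  classical
  refine le_trans ?_ (add_le_add le_rfl (aux_dg_tsum_le (A - B) hb))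
  unfold tailE
  rw [← ENNReal.tsum_add]
  refine ENNReal.tsum_le_tsum fun i => ?_
  split_ifs
  · simp
  unfold dgE
  refine le_trans (le_of_eq ?_) ENNReal.ofReal_add_le
  congr 1
  simp

theorem aux_tail_prod {ι κ : Type*} (t : ι × κ → ENNReal) (F : Finset ι) (G : Finset κ) :
    tailE t (F ×ˢ G) ≤ tailE (fun i => ∑' j, t (i, j)) F + tailE (fun j => ∑' i, t (i, j)) G := by
  classical
  have e1 : tailE (fun i => ∑' j, t (i, j)) F = ∑' p : ι × κ, if p.1 ∈ F then 0 else t p := by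
    rw [ENNReal.tsum_prod']
    refine tsum_congr fun i => ?_
    by_cases hi : i ∈ F <;> simp [hi]
  have e2 : tailE (fun j => ∑' i, t (i, j)) G = ∑' p : ι × κ, if p.2 ∈ G then 0 else t p := by
    rw [ENNReal.tsum_prod', ENNReal.tsum_comm]
    refine tsum_congr fun i => ?_
    by_cases hi : i ∈ G <;> simp [hi]
  rw [e1, e2, ← ENNReal.tsum_add]
  refine ENNReal.tsum_le_tsum fun p => ?_
  by_cases h1 : p.1 ∈ F <;> by_cases h2 : p.2 ∈ G <;> simp [h1, h2]

/-- weak convergence plus uniform tightness gives trace norm convergence -/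
theorem aux_tight {K ι : Type*} [NormedAddCommGroup K] [InnerProductSpace ℂ K] [CompleteSpace K]
    (g : HilbertBasis ι ℂ K) (R : ℕ → K →L[ℂ] K) (hR : ∀ n, (R n).IsPositive)
    (A : K →L[ℂ] K) (hA : A.IsPositive)
    (hw : ∀ x y : K, Tendsto (fun n => ⟪y, R n x⟫) atTop (𝓝 ⟪y, A x⟫))
    (M : ENNReal) (hM : M ≠ ⊤) (hAM : ∑' p, dgE A (g p) ≤ M)
    (hRM : ∀ᶠ n in atTop, ∑' p, dgE (R n) (g p) ≤ M)
    (ht : ∀ ε : ENNReal, 0 < ε → ∃ F : Finset ι, tailE (fun p => dgE A (g p)) F ≤ ε ∧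
      ∀ᶠ n in atTop, tailE (fun p => dgE (R n) (g p)) F ≤ ε) :
    Tendsto (fun n => traceNorm (R n - A)) atTop (𝓝 0) := by
  have hφ : Tendsto (fun ε : ENNReal => 4 * (M ^ (1 / 2 : ℝ) * ε ^ (1 / 2 : ℝ)) + ε)
      (𝓝 0) (𝓝 0) := by
    have h1 : Tendsto (fun ε : ENNReal => ε ^ (1 / 2 : ℝ)) (𝓝 0) (𝓝 0) := by
      have := (ENNReal.continuous_rpow_const (y := (1 / 2 : ℝ))).tendsto 0
      rwa [ENNReal.zero_rpow_of_pos (by norm_num)] at this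
    have h2 := ENNReal.Tendsto.const_mul (a := M ^ (1 / 2 : ℝ)) h1
      (Or.inr (ENNReal.rpow_ne_top_of_nonneg (by norm_num) hM))
    have h3 := ENNReal.Tendsto.const_mul (a := 4) h2 (Or.inr (by norm_num))
    simpa using h3.add tendsto_id
  rw [ENNReal.tendsto_nhds_zero]
  intro η hη
  obtain ⟨ε, hε0, hε⟩ : ∃ ε : ENNReal, 0 < ε ∧
      4 * (M ^ (1 / 2 : ℝ) * ε ^ (1 / 2 : ℝ)) + ε ≤ η := by
    have h1 : ∀ᶠ ε in 𝓝[>] (0 : ENNReal),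
        4 * (M ^ (1 / 2 : ℝ) * ε ^ (1 / 2 : ℝ)) + ε ≤ η :=
      (hφ.mono_left nhdsWithin_le_nhds).eventually (eventually_le_nhds hη)
    haveI : (𝓝[>] (0 : ENNReal)).NeBot := nhdsGT_neBot_of_exists_gt ⟨1, one_pos⟩
    exact (Eventually.and (f := 𝓝[>] (0 : ENNReal)) self_mem_nhdsWithin h1).exists
  obtain ⟨F, hF1, hF2⟩ := ht ε hε0
  have hfin : Tendsto (fun n => ∑ i ∈ F, ∑ j ∈ F, ‖⟪g i, (R n - A) (g j)⟫‖ₑ) atTop (𝓝 0) := by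
    have : Tendsto (fun n => ∑ i ∈ F, ∑ j ∈ F, ‖⟪g i, (R n - A) (g j)⟫‖ₑ) atTop
        (𝓝 (∑ i ∈ F, ∑ j ∈ F, 0)) := by
      refine tendsto_finsetSum _ fun i _ => tendsto_finsetSum _ fun j _ => ?_
      have h := (hw (g j) (g i)).sub_const ⟪g i, A (g j)⟫
      rw [sub_self] at h
      have h' := h.enorm
      rw [enorm_zero] at h'
      refine h'.congr fun n => ?_
      rw [sub_apply, inner_sub_right]
    simpa using this
  filter_upwards [hRM, hF2, hfin.eventually (eventually_le_nhds hε0)] with n h1 h2 h3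
  refine le_trans ?_ hε
  have e : R n - A = (R n - finP g F * R n * finP g F) +
      (-(A - finP g F * A * finP g F) + finP g F * (R n - A) * finP g F) := by
    rw [mul_sub, sub_mul]; abel
  have b1 := aux_trunc g (R n) (hR n) F
  have b2 := aux_trunc g A hA F
  have b3 := aux_finite g.orthonormal (R n - A) F
  have b1' : traceNorm (R n - finP g F * R n * finP g F) ≤
      2 * (M ^ (1 / 2 : ℝ) * ε ^ (1 / 2 : ℝ)) := b1.trans (by gcongr)
  have b2' : traceNorm (A - finP g F * A * finP g F) ≤
      2 * (M ^ (1 / 2 : ℝ) * ε ^ (1 / 2 : ℝ)) := b2.trans (by gcongr)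
  calc traceNorm (R n - A) ≤ traceNorm (R n - finP g F * R n * finP g F) +
        (traceNorm (A - finP g F * A * finP g F) +
          traceNorm (finP g F * (R n - A) * finP g F)) := by
        conv_lhs => rw [e]
        refine (aux_traceNorm_add _ _).trans (add_le_add le_rfl ((aux_traceNorm_add _ _).trans ?_))
        rw [aux_traceNorm_neg]
    _ ≤ 2 * (M ^ (1 / 2 : ℝ) * ε ^ (1 / 2 : ℝ)) + (2 * (M ^ (1 / 2 : ℝ) * ε ^ (1 / 2 : ℝ)) + ε) :=
        add_le_add b1' (add_le_add b2' (b3.trans h3))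
    _ = _ := by ring

variable {H₁ H₂ H : Type*}
  [NormedAddCommGroup H₁] [InnerProductSpace ℂ H₁] [CompleteSpace H₁]
  [TopologicalSpace.SeparableSpace H₁]
  [NormedAddCommGroup H₂] [InnerProductSpace ℂ H₂] [CompleteSpace H₂]
  [TopologicalSpace.SeparableSpace H₂]
  [NormedAddCommGroup H] [InnerProductSpace ℂ H] [CompleteSpace H]
  [TopologicalSpace.SeparableSpace H]

/-- Theorem `wotnrmconv`: if positive semidefinite trace class operators
`ρ⁽ⁿ⁾` on `H = H₁ ⊗ H₂` converge in the weak operator topology to a positive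
semidefinite trace class `ρ`, and
`‖tr₁ρ⁽ⁿ⁾ − ρ₂‖₁ + ‖tr₂ρ⁽ⁿ⁾ − ρ₁‖₁ → 0`, then `‖ρ⁽ⁿ⁾ − ρ‖₁ → 0`; in particular
`tr ρ = tr ρ₁ = tr ρ₂`. -/
theorem weak_op_and_marginal_convergence_implies_traceNorm_convergence
    (h1 : ¬ FiniteDimensional ℂ H₁) (h2 : ¬ FiniteDimensional ℂ H₂)
    (tp : H₁ → H₂ → H) (htp : IsHilbertTensor tp)
    (ρ₁ : H₁ →L[ℂ] H₁) (hρ₁pos : ρ₁.IsPositive) (hρ₁tc : traceNorm ρ₁ ≠ ⊤)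
    (ρ₂ : H₂ →L[ℂ] H₂) (hρ₂pos : ρ₂.IsPositive) (hρ₂tc : traceNorm ρ₂ ≠ ⊤)
    (ρn : ℕ → H →L[ℂ] H) (hρnpos : ∀ n, (ρn n).IsPositive)
    (hρntc : ∀ n, traceNorm (ρn n) ≠ ⊤)
    (ρ : H →L[ℂ] H) (hρpos : ρ.IsPositive) (hρtc : traceNorm ρ ≠ ⊤)
    (hwot : ∀ x y : H, Tendsto (fun n => ⟪y, ρn n x⟫) atTop (𝓝 ⟪y, ρ x⟫))
    (C : ℕ → H₁ →L[ℂ] H₁) (hC : ∀ n, IsPartialTrace₂ tp (ρn n) (C n))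
    (D : ℕ → H₂ →L[ℂ] H₂) (hD : ∀ n, IsPartialTrace₁ tp (ρn n) (D n))
    (hmarg : Tendsto (fun n => traceNorm (D n - ρ₂) + traceNorm (C n - ρ₁))
      atTop (𝓝 0)) :
    Tendsto (fun n => traceNorm (ρn n - ρ)) atTop (𝓝 0) ∧
    opTrace ρ = opTrace ρ₁ ∧ opTrace ρ = opTrace ρ₂ := by
  classical
  obtain ⟨g, hg⟩ := aux_prodBasis htp (hBasis H₁) (hBasis H₂)
  have hδ1 : Tendsto (fun n => traceNorm (C n - ρ₁)) atTop (𝓝 0) :=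
    tendsto_of_tendsto_of_tendsto_of_le_of_le tendsto_const_nhds hmarg
      (fun _ => zero_le) (fun _ => le_add_self)
  have hδ2 : Tendsto (fun n => traceNorm (D n - ρ₂)) atTop (𝓝 0) :=
    tendsto_of_tendsto_of_tendsto_of_le_of_le tendsto_const_nhds hmarg
      (fun _ => zero_le) (fun _ => le_self_add)
  have hT : ∑' p, dgE ρ (g p) ≠ ⊤ := ne_top_of_le_ne_top hρtc (aux_dg_tsum_le ρ g.orthonormal)
  have hTn : ∀ n, ∑' p, dgE (ρn n) (g p) ≠ ⊤ := fun n =>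
    ne_top_of_le_ne_top (hρntc n) (aux_dg_tsum_le (ρn n) g.orthonormal)
  have hT1 : ∑' i, dgE ρ₁ (hBasis H₁ i) ≠ ⊤ :=
    ne_top_of_le_ne_top hρ₁tc (aux_dg_tsum_le ρ₁ (hBasis H₁).orthonormal)
  have hT2 : ∑' i, dgE ρ₂ (hBasis H₂ i) ≠ ⊤ :=
    ne_top_of_le_ne_top hρ₂tc (aux_dg_tsum_le ρ₂ (hBasis H₂).orthonormal)
  have hc : ∀ n i, dgE (C n) (hBasis H₁ i) = ∑' j, dgE (ρn n) (g (i, j)) := fun n i => by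
    refine aux_marg (ρn n) (hρnpos n) (fun j => g (i, j)) ?_ _ ?_
    · refine ne_top_of_le_ne_top (hTn n) ?_
      rw [ENNReal.tsum_prod']
      exact ENNReal.le_tsum (f := fun i => ∑' j, dgE (ρn n) (g (i, j))) i
    · rw [hC n]
      simp only [hg]
  have hd : ∀ n j, dgE (D n) (hBasis H₂ j) = ∑' i, dgE (ρn n) (g (i, j)) := fun n j => by
    refine aux_marg (ρn n) (hρnpos n) (fun i => g (i, j)) ?_ _ ?_
    · refine ne_top_of_le_ne_top (hTn n) ?_
      rw [ENNReal.tsum_prod', ENNReal.tsum_comm]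
      exact ENNReal.le_tsum (f := fun j => ∑' i, dgE (ρn n) (g (i, j))) j
    · rw [hD n]
      simp only [hg]
  have hcT : ∀ n, ∑' i, dgE (C n) (hBasis H₁ i) = ∑' p, dgE (ρn n) (g p) := fun n => by
    simp_rw [hc]
    rw [ENNReal.tsum_prod']
  have hdT : ∀ n, ∑' i, dgE (D n) (hBasis H₂ i) = ∑' p, dgE (ρn n) (g p) := fun n => by
    simp_rw [hd]
    rw [ENNReal.tsum_prod', ENNReal.tsum_comm]
  have main : Tendsto (fun n => traceNorm (ρn n - ρ)) atTop (𝓝 0) := by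
    refine aux_tight g ρn hρnpos ρ hρpos hwot
      (∑' p, dgE ρ (g p) + (∑' i, dgE ρ₁ (hBasis H₁ i) + 1)) ?_ le_self_add ?_ ?_
    · exact ENNReal.add_ne_top.2 ⟨hT, ENNReal.add_ne_top.2 ⟨hT1, ENNReal.one_ne_top⟩⟩
    · filter_upwards [hδ1.eventually (eventually_le_nhds one_pos)] with n hn
      rw [← hcT]
      refine (aux_dg_diff (C n) ρ₁ (hBasis H₁).orthonormal).trans ?_
      exact le_trans (add_le_add le_rfl hn) le_add_self
    · intro ε hε
      have h4 : 0 < ε / 4 := ENNReal.div_pos hε.ne' (by norm_num)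
      obtain ⟨F₁, hF₁⟩ := ((aux_tail_tendsto _ hT1).eventually (eventually_le_nhds h4)).exists
      obtain ⟨F₂, hF₂⟩ := ((aux_tail_tendsto _ hT2).eventually (eventually_le_nhds h4)).exists
      obtain ⟨G, hG⟩ := ((aux_tail_tendsto _ hT).eventually (eventually_le_nhds hε)).exists
      refine ⟨G ∪ F₁ ×ˢ F₂, (aux_tail_anti _ Finset.subset_union_left).trans hG, ?_⟩
      filter_upwards [hδ1.eventually (eventually_le_nhds h4),
        hδ2.eventually (eventually_le_nhds h4)] with n hn1 hn2
      refine (aux_tail_anti _ Finset.subset_union_right).trans ?_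
      refine (aux_tail_prod _ F₁ F₂).trans ?_
      have k1 := aux_dg_tail_diff (C n) ρ₁ (hBasis H₁).orthonormal F₁
      have k2 := aux_dg_tail_diff (D n) ρ₂ (hBasis H₂).orthonormal F₂
      simp_rw [hc] at k1
      simp_rw [hd] at k2
      refine (add_le_add (k1.trans (add_le_add hF₁ hn1)) (k2.trans (add_le_add hF₂ hn2))).trans ?_
      apply le_of_eq
      rw [← two_mul, ← two_mul, ← mul_assoc]
      norm_num
      exact ENNReal.mul_div_cancel (by norm_num) (by norm_num)
  have tr : ∀ a : ENNReal, ∀ δ : ℕ → ENNReal, Tendsto δ atTop (𝓝 0) →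
      (∀ n, ∑' p, dgE (ρn n) (g p) ≤ a + δ n) → (∀ n, a ≤ ∑' p, dgE (ρn n) (g p) + δ n) →
      ∑' p, dgE ρ (g p) = a := by
    intro a δ hδ u1 u2
    have hs := hδ.add main
    rw [add_zero] at hs
    apply le_antisymm
    · have := (tendsto_const_nhds (x := a)).add hs
      rw [add_zero] at this
      refine ge_of_tendsto' this fun n => ?_
      have q := aux_dg_diff ρ (ρn n) g.orthonormal
      rw [aux_sub_comm] at q
      refine q.trans ?_
      rw [← add_assoc]
      exact add_le_add (u1 n) le_rfl
    · have := (tendsto_const_nhds (x := ∑' p, dgE ρ (g p))).add hs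
      rw [add_zero] at this
      refine ge_of_tendsto' this fun n => ?_
      have q := aux_dg_diff (ρn n) ρ g.orthonormal
      refine (u2 n).trans ((add_le_add q le_rfl).trans (le_of_eq ?_))
      ring
  refine ⟨main, ?_, ?_⟩
  · rw [aux_opTrace ρ hρpos hρtc, aux_opTrace ρ₁ hρ₁pos hρ₁tc, aux_basis_indep _ g ρ hρpos,
      tr _ _ hδ1 (fun n => ?_) (fun n => ?_)]
    · rw [← hcT]; exact aux_dg_diff _ _ (hBasis H₁).orthonormal
    · rw [← hcT, aux_sub_comm]; exact aux_dg_diff _ _ (hBasis H₁).orthonormal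
  · rw [aux_opTrace ρ hρpos hρtc, aux_opTrace ρ₂ hρ₂pos hρ₂tc, aux_basis_indep _ g ρ hρpos,
      tr _ _ hδ2 (fun n => ?_) (fun n => ?_)]
    · rw [← hdT]; exact aux_dg_diff _ _ (hBasis H₂).orthonormal
    · rw [← hdT, aux_sub_comm]; exact aux_dg_diff _ _ (hBasis H₂).orthonormal
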